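/- Let N₁, N₂ ∈ ℝ⁸ be orthonormal vectors, V = {x ∈ ℝ⁸ : ⟨x,N₁⟩ = ⟨x,N₂⟩ = 0}, Jx = P(N₁,N₂,x) for x ∈ V, and ω(x,y) = ⟨x, Jy⟩ for x, y ∈ V. Then for all x₁, x₂, x₃, x₄ ∈ V: Φ(x₁,x₂,x₃,x₄) = −(σ/2)(ω∧ω)(x₁,x₂,x₃,x₄). (Pointwise form of the relation −2σ f*Φ = ω∧ω between the fundamental 4-form and the Kähler form of the induced almost Hermitian structure on a 6-dimensional submanifold.) -/

import Mathlib

open scoped BigOperators RealInnerProductSpace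

noncomputable section

abbrev Form (n p : ℕ) := (Fin p → EuclideanSpace ℝ (Fin n)) → ℝ

namespace Form

/-- Wedge product of forms (shuffle convention; full antisymmetrization divided by p!q!). -/
def wedge {n p q : ℕ} (α : Form n p) (β : Form n q) : Form n (p + q) :=
  fun x =>
    (((p.factorial * q.factorial : ℕ) : ℝ))⁻¹ *
      ∑ σ : Equiv.Perm (Fin (p + q)),
        ((Equiv.Perm.sign σ : ℤ) : ℝ) *
          (α fun i => x (σ (Fin.castAdd q i))) * (β fun j => x (σ (Fin.natAdd p j)))

/-- Inner product of `p`-forms. -/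
def inner' {n p : ℕ} (α β : Form n p) : ℝ :=
  ((p.factorial : ℕ) : ℝ)⁻¹ *
    ∑ f : Fin p → Fin n,
      (α fun k => EuclideanSpace.single (f k) 1) * (β fun k => EuclideanSpace.single (f k) 1)

/-- Interior product of a vector and a form. -/
def iprod {n p : ℕ} (v : EuclideanSpace ℝ (Fin n)) (α : Form n (p + 1)) : Form n p :=
  fun x => α (Fin.cons v x)

end Form

infixl:72 " ⋏ " => Form.wedge

/-- The 1-form dual to a vector. -/
def dual {n : ℕ} (v : EuclideanSpace ℝ (Fin n)) : Form n 1 := fun x => ⟪v, x 0⟫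

abbrev E8 := EuclideanSpace ℝ (Fin 8)

/-- The basis vector `e`. -/
def e8 : E8 := EuclideanSpace.single 7 1

/-- The basis vectors `e₀,…,e₆` indexed mod 7. -/
def u7 (i : ZMod 7) : E8 := EuclideanSpace.single ⟨i.val, i.val_lt.trans (by norm_num)⟩ 1

/-- The basis indexed by ℤ₈, with `e₇ = e`. -/
def u8 (i : ZMod 8) : E8 := EuclideanSpace.single ⟨i.val, i.val_lt⟩ 1

/-- The Spin(7) fundamental 4-form. -/
def Phi (σ : ℝ) : Form 8 4 := fun x =>
  (∑ i : ZMod 7, (dual e8 ⋏ dual (u7 i) ⋏ dual (u7 (i + 1)) ⋏ dual (u7 (i + 3))) x)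
    - σ * ∑ i : ZMod 7,
        (dual (u7 (i + 2)) ⋏ dual (u7 (i + 4)) ⋏ dual (u7 (i + 5)) ⋏ dual (u7 (i + 6))) x

/-- The standard volume form of ℝ⁸. -/
def vol8 : Form 8 8 :=
  dual e8 ⋏ dual (u7 0) ⋏ dual (u7 1) ⋏ dual (u7 2) ⋏ dual (u7 3) ⋏ dual (u7 4) ⋏ dual (u7 5)
    ⋏ dual (u7 6)

/-- The 2-forms spanning spin(7)ᗮ. -/
def beta (σ : ℝ) (i : ZMod 7) : Form 8 2 := fun x =>
  σ * (dual (u7 i) ⋏ dual e8) x + (dual (u7 (i + 1)) ⋏ dual (u7 (i + 3))) x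
    + (dual (u7 (i + 4)) ⋏ dual (u7 (i + 5))) x + (dual (u7 (i + 2)) ⋏ dual (u7 (i + 6))) x

/-- The form `x ↦ det ⟪v j, x i⟫`. -/
def detForm {n p : ℕ} (v : Fin p → EuclideanSpace ℝ (Fin n)) :
    EuclideanSpace ℝ (Fin n) [⋀^Fin p]→ₗ[ℝ] ℝ :=
  Matrix.detRowAlternating.compLinearMap (LinearMap.pi fun j => innerₛₗ ℝ (v j))

theorem detForm_apply {n p : ℕ} (v x : Fin p → EuclideanSpace ℝ (Fin n)) :
    detForm v x = ∑ τ : Equiv.Perm (Fin p), ((Equiv.Perm.sign τ : ℤ) : ℝ) *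
      ∏ j, ⟪v j, x (τ j)⟫ := by
  exact Matrix.det_apply' (fun i j => ⟪v j, x i⟫)

theorem dual_eq_detForm {n : ℕ} (v : EuclideanSpace ℝ (Fin n)) : dual v = ⇑(detForm ![v]) := by
  ext x
  simp [detForm_apply, dual]

theorem detForm_wedge_dual {n p : ℕ} (v : Fin p → EuclideanSpace ℝ (Fin n))
    (w : EuclideanSpace ℝ (Fin n)) :
    Form.wedge ⇑(detForm v) (dual w) = ⇑(detForm (Fin.snoc v w : Fin (p + 1) → _)) := by
  ext x
  let f : Equiv.Perm (Fin p) → Equiv.Perm (Fin (p + 1)) := fun τ =>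
    finSumFinEquiv.permCongr (Equiv.Perm.sumCongr τ 1)
  have hs (τ) : Equiv.Perm.sign (f τ) = Equiv.Perm.sign τ := by
    simp [f, Equiv.Perm.sign_permCongr]
  have hc (τ) (j : Fin p) : f τ j.castSucc = (τ j).castSucc := by
    have : j.castSucc = finSumFinEquiv (Sum.inl j : Fin p ⊕ Fin 1) := rfl
    rw [this]
    simp only [f, Equiv.permCongr_apply, Equiv.symm_apply_apply]
    simp
    rfl
  have hl (τ) : f τ (Fin.last p) = Fin.last p := by
    have : Fin.last p = finSumFinEquiv (Sum.inr 0 : Fin p ⊕ Fin 1) := rfl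
    rw [this]
    simp only [f, Equiv.permCongr_apply, Equiv.symm_apply_apply]
    simp
  have key (σ τ) : ((Equiv.Perm.sign (σ * f τ) : ℤ) : ℝ) * ∏ j,
      ⟪(Fin.snoc v w : Fin (p + 1) → _) j, x ((σ * f τ) j)⟫ =
      ((Equiv.Perm.sign σ : ℤ) : ℝ) * (((Equiv.Perm.sign τ : ℤ) : ℝ) *
        ∏ j, ⟪v j, x (σ (Fin.castAdd 1 (τ j)))⟫) * ⟪w, x (σ (Fin.natAdd p 0))⟫ := by
    rw [Fin.prod_univ_castSucc]
    simp only [Equiv.Perm.mul_apply, hc, hl, Fin.snoc_castSucc, Fin.snoc_last,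
      Equiv.Perm.sign_mul, hs]
    push_cast
    change _ * _ * (_ * ⟪w, x (σ (Fin.natAdd p 0))⟫) = _
    rw [← mul_assoc, ← mul_assoc]
    rfl
  have hsum (τ) : ∑ σ : Equiv.Perm (Fin (p + 1)), ((Equiv.Perm.sign σ : ℤ) : ℝ) *
      (((Equiv.Perm.sign τ : ℤ) : ℝ) * ∏ j, ⟪v j, x (σ (Fin.castAdd 1 (τ j)))⟫) *
        ⟪w, x (σ (Fin.natAdd p 0))⟫ = detForm (Fin.snoc v w : Fin (p + 1) → _) x := by
    rw [detForm_apply]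
    refine Eq.trans ?_ (Equiv.sum_comp (Equiv.mulRight (f τ)) _)
    exact Finset.sum_congr rfl fun σ _ => (key σ τ).symm
  have hp : (p.factorial : ℝ) ≠ 0 := by positivity
  calc Form.wedge (⇑(detForm v)) (dual w) x
      = (p.factorial : ℝ)⁻¹ * ∑ τ : Equiv.Perm (Fin p), ∑ σ : Equiv.Perm (Fin (p + 1)),
          ((Equiv.Perm.sign σ : ℤ) : ℝ) * (((Equiv.Perm.sign τ : ℤ) : ℝ) *
            ∏ j, ⟪v j, x (σ (Fin.castAdd 1 (τ j)))⟫) * ⟪w, x (σ (Fin.natAdd p 0))⟫ := by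
        rw [Finset.sum_comm]
        simp only [← Finset.sum_mul, ← Finset.mul_sum]
        unfold Form.wedge
        simp only [detForm_apply, dual, Nat.factorial_one, mul_one]
    _ = detForm (Fin.snoc v w : Fin (p + 1) → _) x := by
        rw [Finset.sum_congr rfl fun τ _ => hsum τ, Finset.sum_const, Finset.card_univ,
          Fintype.card_perm, Fintype.card_fin, nsmul_eq_mul, inv_mul_cancel_left₀ hp]

theorem wedge_dual_four {n : ℕ} (a b c d : EuclideanSpace ℝ (Fin n)) :
    (dual a ⋏ dual b ⋏ dual c ⋏ dual d) = ⇑(detForm ![a, b, c, d]) := by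
  rw [dual_eq_detForm a, detForm_wedge_dual, detForm_wedge_dual, detForm_wedge_dual]
  congr 2
  ext i : 1
  fin_cases i <;> rfl

/-- The Pfaffian expansion of the antisymmetrization of `g ⊗ g`. -/
theorem sum_perm_four_mul (g : Fin 4 → Fin 4 → ℝ) (hg : ∀ i j, g j i = -g i j) :
    ∑ σ : Equiv.Perm (Fin 4), ((Equiv.Perm.sign σ : ℤ) : ℝ) * g (σ 0) (σ 1) * g (σ 2) (σ 3) =
      8 * (g 0 1 * g 2 3 - g 0 2 * g 1 3 + g 0 3 * g 1 2) := by
  have h₂ (e : Equiv.Perm (Fin 3)) (p : Fin 4) :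
      Equiv.Perm.decomposeFin.symm (p, e) 2 = Equiv.swap 0 p (e 1).succ :=
    Equiv.Perm.decomposeFin_symm_apply_succ e p 1
  have h₃ (e : Equiv.Perm (Fin 3)) (p : Fin 4) :
      Equiv.Perm.decomposeFin.symm (p, e) 3 = Equiv.swap 0 p (e 2).succ :=
    Equiv.Perm.decomposeFin_symm_apply_succ e p 2
  have h₂' (e : Equiv.Perm (Fin 2)) (p : Fin 3) :
      Equiv.Perm.decomposeFin.symm (p, e) 2 = Equiv.swap 0 p (e 1).succ :=
    Equiv.Perm.decomposeFin_symm_apply_succ e p 1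
  simp only [← Equiv.sum_comp (Equiv.Perm.decomposeFin (n := 3)).symm,
    ← Equiv.sum_comp (Equiv.Perm.decomposeFin (n := 2)).symm,
    ← Equiv.sum_comp (Equiv.Perm.decomposeFin (n := 1)).symm, Fintype.sum_prod_type,
    Equiv.Perm.decomposeFin_symm_apply_zero, Equiv.Perm.decomposeFin_symm_apply_one, h₂, h₃, h₂',
    Fin.sum_univ_four, Fin.sum_univ_three, Fin.sum_univ_two, Equiv.Perm.decomposeFin.symm_sign,
    Fintype.sum_unique, Subsingleton.elim (default : Equiv.Perm (Fin 1)) 1,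
    Equiv.Perm.sign_one, Equiv.Perm.one_apply]
  simp only [Equiv.swap_apply_def]
  simp +decide only [Fin.reduceSucc, if_true, if_false, Units.val_mul, Units.val_neg,
    Units.val_one, Int.cast_mul, Int.cast_neg, Int.cast_one]
  simp only [hg 0 1, hg 0 2, hg 0 3, hg 1 2, hg 1 3, hg 2 3]
  ring

theorem wedge_self_apply {n : ℕ} (ω : Form n 2) (hω : ∀ x y, ω ![y, x] = -ω ![x, y])
    (x : Fin 4 → EuclideanSpace ℝ (Fin n)) :
    (ω ⋏ ω) x = 2 * (ω ![x 0, x 1] * ω ![x 2, x 3] - ω ![x 0, x 2] * ω ![x 1, x 3]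
      + ω ![x 0, x 3] * ω ![x 1, x 2]) := by
  have h (y : Fin 2 → EuclideanSpace ℝ (Fin n)) : ω y = ω ![y 0, y 1] := by
    congr 1; ext i : 1; fin_cases i <;> rfl
  have key := sum_perm_four_mul (fun i j => ω ![x i, x j]) fun i j => hω _ _
  have hw : (ω ⋏ ω) x = ((Nat.factorial 2 * Nat.factorial 2 : ℕ) : ℝ)⁻¹ *
      ∑ σ : Equiv.Perm (Fin 4), ((Equiv.Perm.sign σ : ℤ) : ℝ) *
        ω ![x (σ 0), x (σ 1)] * ω ![x (σ 2), x (σ 3)] := by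
    unfold Form.wedge
    congr 1
    refine Finset.sum_congr rfl fun σ _ => ?_
    rw [h (fun i => x (σ (Fin.castAdd 2 i))), h (fun j => x (σ (Fin.natAdd 2 j)))]
    rfl
  rw [hw, key]
  norm_num [Nat.factorial]
  ring

theorem detForm_four {n : ℕ} (a b c d x y z w : EuclideanSpace ℝ (Fin n)) :
    detForm ![a, b, c, d] ![x, y, z, w] =
      (⟪a, x⟫ * ⟪b, y⟫ - ⟪b, x⟫ * ⟪a, y⟫) * (⟪c, z⟫ * ⟪d, w⟫ - ⟪d, z⟫ * ⟪c, w⟫)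
      - (⟪a, x⟫ * ⟪c, y⟫ - ⟪c, x⟫ * ⟪a, y⟫) * (⟪b, z⟫ * ⟪d, w⟫ - ⟪d, z⟫ * ⟪b, w⟫)
      + (⟪a, x⟫ * ⟪d, y⟫ - ⟪d, x⟫ * ⟪a, y⟫) * (⟪b, z⟫ * ⟪c, w⟫ - ⟪c, z⟫ * ⟪b, w⟫)
      + (⟪b, x⟫ * ⟪c, y⟫ - ⟪c, x⟫ * ⟪b, y⟫) * (⟪a, z⟫ * ⟪d, w⟫ - ⟪d, z⟫ * ⟪a, w⟫)
      - (⟪b, x⟫ * ⟪d, y⟫ - ⟪d, x⟫ * ⟪b, y⟫) * (⟪a, z⟫ * ⟪c, w⟫ - ⟪c, z⟫ * ⟪a, w⟫)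
      + (⟪c, x⟫ * ⟪d, y⟫ - ⟪d, x⟫ * ⟪c, y⟫) * (⟪a, z⟫ * ⟪b, w⟫ - ⟪b, z⟫ * ⟪a, w⟫) := by
  change Matrix.det (Matrix.of fun i j => ⟪(![a, b, c, d] : Fin 4 → _) j,
    (![x, y, z, w] : Fin 4 → _) i⟫) = _
  simp [Matrix.det_succ_row_zero, Fin.sum_univ_succ, Fin.succAbove]
  ring

/-- The `2 × 2` minors of a pair of vectors, their Plücker coordinates. -/
def minor (x y : E8) (a b : Fin 8) : ℝ := x a * y b - x b * y a

/-- The value of `e_a ∧ e_b ∧ e_c ∧ e_d` on four vectors, by Laplace expansion along pairs. -/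
def lap (x y z w : E8) (a b c d : Fin 8) : ℝ :=
  minor x y a b * minor z w c d - minor x y a c * minor z w b d + minor x y a d * minor z w b c
  + minor x y b c * minor z w a d - minor x y b d * minor z w a c + minor x y c d * minor z w a b

theorem lap_add (x x' y z w : E8) (a b c d : Fin 8) :
    lap (x + x') y z w a b c d = lap x y z w a b c d + lap x' y z w a b c d := by
  simp only [lap, minor, PiLp.add_apply]
  ring

theorem lap_smul (r : ℝ) (x y z w : E8) (a b c d : Fin 8) :
    lap (r • x) y z w a b c d = r * lap x y z w a b c d := by
  simp only [lap, minor, PiLp.smul_apply, smul_eq_mul]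
  ring

theorem lap_swap₁₂ (x y z w : E8) (a b c d : Fin 8) :
    lap y x z w a b c d = -lap x y z w a b c d := by
  simp only [lap, minor]
  ring

theorem lap_swap₂₃ (x y z w : E8) (a b c d : Fin 8) :
    lap x z y w a b c d = -lap x y z w a b c d := by
  simp only [lap, minor]
  ring

theorem lap_swap₃₄ (x y z w : E8) (a b c d : Fin 8) :
    lap x y w z a b c d = -lap x y z w a b c d := by
  simp only [lap, minor]
  ring

theorem inner_u7 (i : ZMod 7) (x : E8) : ⟪u7 i, x⟫ = x (Fin.castSucc (n := 7) i) := by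
  simp only [u7, EuclideanSpace.inner_single_left, map_one, one_mul]
  rfl

theorem inner_e8 (x : E8) : ⟪e8, x⟫ = x 7 := by
  simp [e8, EuclideanSpace.inner_single_left]

/-- The fundamental 4-form as a polynomial in the coordinates. -/
def phi (σ : ℝ) (x y z w : E8) : ℝ :=
  (lap x y z w 7 0 1 3 + lap x y z w 7 1 2 4 + lap x y z w 7 2 3 5 + lap x y z w 7 3 4 6
    + lap x y z w 7 4 5 0 + lap x y z w 7 5 6 1 + lap x y z w 7 6 0 2)
  - σ * (lap x y z w 2 4 5 6 + lap x y z w 3 5 6 0 + lap x y z w 4 6 0 1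
    + lap x y z w 5 0 1 2 + lap x y z w 6 1 2 3 + lap x y z w 0 2 3 4
    + lap x y z w 1 3 4 5)

theorem Phi_apply (σ : ℝ) (x y z w : E8) : Phi σ ![x, y, z, w] = phi σ x y z w := by
  have hs (f : ZMod 7 → ℝ) : ∑ i, f i = f 0 + f 1 + f 2 + f 3 + f 4 + f 5 + f 6 :=
    Fin.sum_univ_seven f
  simp only [Phi, wedge_dual_four, hs, detForm_four, inner_e8, inner_u7]
  rfl

theorem phi_add (σ : ℝ) (x x' y z w : E8) :
    phi σ (x + x') y z w = phi σ x y z w + phi σ x' y z w := by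
  simp only [phi, lap_add]
  ring

theorem phi_smul (σ r : ℝ) (x y z w : E8) : phi σ (r • x) y z w = r * phi σ x y z w := by
  simp only [phi, lap_smul]
  ring

theorem phi_swap₁₂ (σ : ℝ) (x y z w : E8) : phi σ y x z w = -phi σ x y z w := by
  simp only [phi, lap_swap₁₂ x y z w]
  ring

theorem phi_swap₂₃ (σ : ℝ) (x y z w : E8) : phi σ x z y w = -phi σ x y z w := by
  simp only [phi, lap_swap₂₃ x y z w]
  ring

theorem phi_swap₃₄ (σ : ℝ) (x y z w : E8) : phi σ x y w z = -phi σ x y z w := by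
  simp only [phi, lap_swap₃₄ x y z w]
  ring

/-- A trilinear alternating function vanishes as soon as it vanishes on increasing triples of
standard basis vectors. -/
theorem eq_zero_of_antisymm {n : ℕ}
    {F : EuclideanSpace ℝ (Fin n) → EuclideanSpace ℝ (Fin n) → EuclideanSpace ℝ (Fin n) → ℝ}
    (hadd : ∀ x x' y z, F (x + x') y z = F x y z + F x' y z)
    (hsmul : ∀ (r : ℝ) x y z, F (r • x) y z = r * F x y z)
    (h₁₂ : ∀ x y z, F y x z = -F x y z) (h₂₃ : ∀ x y z, F x z y = -F x y z)
    (hb : ∀ i j k : Fin n, i < j → j < k → F (EuclideanSpace.single i 1)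
      (EuclideanSpace.single j 1) (EuclideanSpace.single k 1) = 0)
    (x y z : EuclideanSpace ℝ (Fin n)) : F x y z = 0 := by
  have hlin (y z) (h : ∀ i, F (EuclideanSpace.single i 1) y z = 0) (x) : F x y z = 0 := by
    let L : EuclideanSpace ℝ (Fin n) →ₗ[ℝ] ℝ :=
      { toFun := fun x => F x y z
        map_add' := fun x x' => hadd x x' y z
        map_smul' := fun r x => hsmul r x y z }
    have hL : L = 0 := (EuclideanSpace.basisFun (Fin n) ℝ).toBasis.ext fun i => by
      simpa [L] using h i
    exact LinearMap.congr_fun hL x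
  have h₁ (x z) : F x x z = 0 := by linarith [h₁₂ x x z]
  have h₂ (x y) : F x y y = 0 := by linarith [h₂₃ x y y]
  have hlt (i j k : Fin n) (hij : i < j) : F (EuclideanSpace.single i 1)
      (EuclideanSpace.single j 1) (EuclideanSpace.single k 1) = 0 := by
    rcases lt_trichotomy j k with h | rfl | h
    · exact hb i j k hij h
    · exact h₂ _ _
    · rw [h₂₃, neg_eq_zero]
      rcases lt_trichotomy i k with h' | rfl | h'
      · exact hb i k j h' h
      · exact h₁ _ _
      · rw [h₁₂, neg_eq_zero]
        exact hb k i j h' hij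
  refine hlin y z (fun i => ?_) x
  rw [h₁₂, neg_eq_zero]
  refine hlin _ z (fun j => ?_) y
  rw [h₁₂, h₂₃, neg_neg, h₁₂, neg_eq_zero]
  refine hlin _ _ (fun k => ?_) z
  rcases lt_trichotomy k i with h | rfl | h
  · exact hlt k i j h
  · exact h₁ _ _
  · rw [h₁₂, neg_eq_zero]
    exact hlt i k j h

/-- The `3 × 3` minors of a triple of vectors. -/
def det₃ (a b c : E8) (p q r : Fin 8) : ℝ :=
  minor a b p q * c r - minor a b p r * c q + minor a b q r * c p

/-- The coordinates of the three-fold cross product. -/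
def cross (σ : ℝ) (a b c : E8) : Fin 8 → ℝ
  | 0 => det₃ a b c 1 3 7 + det₃ a b c 2 6 7 + det₃ a b c 4 5 7
      - σ * (det₃ a b c 1 2 5 + det₃ a b c 1 6 4 + det₃ a b c 2 4 3 + det₃ a b c 3 5 6)
  | 1 => det₃ a b c 0 7 3 + det₃ a b c 2 4 7 + det₃ a b c 5 6 7
      - σ * (det₃ a b c 0 4 6 + det₃ a b c 0 5 2 + det₃ a b c 2 3 6 + det₃ a b c 3 5 4)
  | 2 => det₃ a b c 0 7 6 + det₃ a b c 1 7 4 + det₃ a b c 3 5 7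
      - σ * (det₃ a b c 0 1 5 + det₃ a b c 0 3 4 + det₃ a b c 1 6 3 + det₃ a b c 4 6 5)
  | 3 => det₃ a b c 0 1 7 + det₃ a b c 2 7 5 + det₃ a b c 4 6 7
      - σ * (det₃ a b c 0 4 2 + det₃ a b c 0 6 5 + det₃ a b c 1 2 6 + det₃ a b c 1 4 5)
  | 4 => det₃ a b c 0 7 5 + det₃ a b c 1 2 7 + det₃ a b c 3 7 6
      - σ * (det₃ a b c 0 2 3 + det₃ a b c 0 6 1 + det₃ a b c 1 5 3 + det₃ a b c 2 5 6)
  | 5 => det₃ a b c 0 4 7 + det₃ a b c 1 7 6 + det₃ a b c 2 3 7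
      - σ * (det₃ a b c 0 2 1 + det₃ a b c 0 3 6 + det₃ a b c 1 3 4 + det₃ a b c 2 6 4)
  | 6 => det₃ a b c 0 2 7 + det₃ a b c 1 5 7 + det₃ a b c 3 4 7
      - σ * (det₃ a b c 0 1 4 + det₃ a b c 0 5 3 + det₃ a b c 1 3 2 + det₃ a b c 2 4 5)
  | 7 => det₃ a b c 0 3 1 + det₃ a b c 0 5 4 + det₃ a b c 0 6 2 + det₃ a b c 1 4 2
      + det₃ a b c 1 6 5 + det₃ a b c 2 5 3 + det₃ a b c 3 6 4

theorem phi_single_right (σ : ℝ) (a b c : E8) (h : Fin 8) :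
    phi σ a b c (EuclideanSpace.single h 1) = cross σ a b c h := by
  fin_cases h <;> simp [phi, lap, minor, cross, det₃] <;> ring

theorem minor_single (i j a b : Fin 8) :
    minor (EuclideanSpace.single i 1) (EuclideanSpace.single j 1) a b =
      (if a = i then 1 else 0) * (if b = j then 1 else 0)
        - (if b = i then 1 else 0) * (if a = j then 1 else 0) := by
  simp [minor]

set_option maxHeartbeats 2000000 in
theorem sum_cross_mul_cross_single {σ : ℝ} (hσ : σ = 1 ∨ σ = -1) (a b c : E8) (i j k : Fin 8)
    (hij : i < j) (hjk : j < k) :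
    let x : E8 := EuclideanSpace.single i 1
    let y : E8 := EuclideanSpace.single j 1
    let z : E8 := EuclideanSpace.single k 1
    ∑ h, cross σ a b c h * cross σ x y z h
      = det₃ a b c i j k
      - σ * (a i * cross σ b c y k + a j * cross σ b c z i + a k * cross σ b c x j
        + b i * cross σ c a y k + b j * cross σ c a z i + b k * cross σ c a x j
        + c i * cross σ a b y k + c j * cross σ a b z i + c k * cross σ a b x j) := by
  intro x y z
  obtain ⟨A, hA⟩ : ∃ A, cross σ a b c = A := ⟨_, rfl⟩
  rw [hA]
  fin_cases i <;> fin_cases j <;> first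
    | exact absurd hij (by decide)
    | (fin_cases k <;> first
        | exact absurd hjk (by decide)
        | (simp only [x, y, z, Fin.sum_univ_eight, cross, minor_single, det₃, PiLp.single_apply,
             reduceIte, mul_zero, mul_one, sub_zero, zero_sub, add_zero, zero_add,
             mul_neg, Fin.isValue, Fin.reduceEq, Fin.zero_eta, Fin.mk_one,
             Fin.reduceFinMk]
           subst hA
           rcases hσ with rfl | rfl <;> simp only [cross, det₃, minor] <;> ring))

theorem phi_comm (σ : ℝ) (x y z w : E8) : phi σ z w x y = phi σ x y z w := by
  linarith [phi_swap₂₃ σ z w x y, phi_swap₁₂ σ x z w y, phi_swap₂₃ σ x w z y,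
    phi_swap₃₄ σ z x w y, phi_swap₃₄ σ x z w y, phi_swap₂₃ σ x z y w, phi_swap₁₂ σ x z y w,
    phi_swap₁₂ σ z x w y]

theorem phi_add₃ (σ : ℝ) (x x' y z w : E8) :
    phi σ y z (x + x') w = phi σ y z x w + phi σ y z x' w := by
  simp only [← phi_comm σ y z, phi_add]

theorem phi_smul₃ (σ r : ℝ) (x y z w : E8) : phi σ y z (r • x) w = r * phi σ y z x w := by
  simp only [← phi_comm σ y z, phi_smul]

theorem phi_add₄ (σ : ℝ) (x x' y z w : E8) :
    phi σ y z w (x + x') = phi σ y z w x + phi σ y z w x' := by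
  simp only [phi_swap₃₄ σ y z _ w, phi_add₃, neg_add]

theorem phi_smul₄ (σ r : ℝ) (x y z w : E8) : phi σ y z w (r • x) = r * phi σ y z w x := by
  simp only [phi_swap₃₄ σ y z _ w, phi_smul₃, mul_neg]

/-- The inner product of two three-fold cross products. -/
theorem sum_phi_mul_phi {σ : ℝ} (hσ : σ = 1 ∨ σ = -1) (a b c x y z : E8) :
    ∑ h, phi σ a b c (EuclideanSpace.single h 1) * phi σ x y z (EuclideanSpace.single h 1)
      = ⟪a, x⟫ * (⟪b, y⟫ * ⟪c, z⟫ - ⟪b, z⟫ * ⟪c, y⟫) - ⟪a, y⟫ * (⟪b, x⟫ * ⟪c, z⟫ - ⟪b, z⟫ * ⟪c, x⟫)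
        + ⟪a, z⟫ * (⟪b, x⟫ * ⟪c, y⟫ - ⟪b, y⟫ * ⟪c, x⟫)
      - σ * (⟪a, x⟫ * phi σ b c y z + ⟪a, y⟫ * phi σ b c z x + ⟪a, z⟫ * phi σ b c x y
        + ⟪b, x⟫ * phi σ c a y z + ⟪b, y⟫ * phi σ c a z x + ⟪b, z⟫ * phi σ c a x y
        + ⟪c, x⟫ * phi σ a b y z + ⟪c, y⟫ * phi σ a b z x + ⟪c, z⟫ * phi σ a b x y) := by
  rw [← sub_eq_zero]
  refine eq_zero_of_antisymm (F := fun x y z =>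
    ∑ h, phi σ a b c (EuclideanSpace.single h 1) * phi σ x y z (EuclideanSpace.single h 1)
      - (⟪a, x⟫ * (⟪b, y⟫ * ⟪c, z⟫ - ⟪b, z⟫ * ⟪c, y⟫)
        - ⟪a, y⟫ * (⟪b, x⟫ * ⟪c, z⟫ - ⟪b, z⟫ * ⟪c, x⟫)
        + ⟪a, z⟫ * (⟪b, x⟫ * ⟪c, y⟫ - ⟪b, y⟫ * ⟪c, x⟫)
      - σ * (⟪a, x⟫ * phi σ b c y z + ⟪a, y⟫ * phi σ b c z x + ⟪a, z⟫ * phi σ b c x y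
        + ⟪b, x⟫ * phi σ c a y z + ⟪b, y⟫ * phi σ c a z x + ⟪b, z⟫ * phi σ c a x y
        + ⟪c, x⟫ * phi σ a b y z + ⟪c, y⟫ * phi σ a b z x + ⟪c, z⟫ * phi σ a b x y)))
    ?_ ?_ ?_ ?_ ?_ x y z
  · intro x x' y z
    simp only [phi_add, phi_add₃, phi_add₄, inner_add_right, mul_add, Finset.sum_add_distrib]
    ring
  · intro r x y z
    simp only [phi_smul, phi_smul₃, phi_smul₄, real_inner_smul_right, mul_left_comm _ r,
      ← Finset.mul_sum]
    ring
  · intro x y z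
    simp only [phi_swap₁₂ σ x y z, mul_neg, Finset.sum_neg_distrib, phi_swap₃₄ σ _ _ x y,
      phi_swap₃₄ σ _ _ y z, phi_swap₃₄ σ _ _ z x]
    ring
  · intro x y z
    simp only [phi_swap₂₃ σ x y z, mul_neg, Finset.sum_neg_distrib, phi_swap₃₄ σ _ _ x y,
      phi_swap₃₄ σ _ _ y z, phi_swap₃₄ σ _ _ z x]
    ring
  · intro i j k hij hjk
    have h := sum_cross_mul_cross_single hσ a b c i j k hij hjk
    simp only [det₃, minor] at h
    simp only [phi_single_right, h, EuclideanSpace.inner_single_right, conj_trivial, one_mul]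
    ring

/-- with `Jx = P(N₁,N₂,x)` and `ω(x,y) = ⟨x,Jy⟩` on
`V = {x : ⟨x,N₁⟩ = ⟨x,N₂⟩ = 0}`, for all `x₁,x₂,x₃,x₄ ∈ V`:
`Φ(x₁,x₂,x₃,x₄) = −(σ/2)(ω∧ω)(x₁,x₂,x₃,x₄)`. -/
theorem stmt17 (σ : ℝ) (hσ : σ = 1 ∨ σ = -1)
    (P : E8 → E8 → E8 → E8) (hP : ∀ x y z w : E8, ⟪P x y z, w⟫ = Phi σ ![x, y, z, w])
    (N₁ N₂ : E8) (hN₁ : ⟪N₁, N₁⟫ = 1) (hN₂ : ⟪N₂, N₂⟫ = 1) (hN₁₂ : ⟪N₁, N₂⟫ = 0)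
    (ω : Form 8 2) (hω : ∀ v : Fin 2 → E8, ω v = ⟪v 0, P N₁ N₂ (v 1)⟫)
    (x₁ x₂ x₃ x₄ : E8)
    (h₁ : ⟪x₁, N₁⟫ = 0) (h₁' : ⟪x₁, N₂⟫ = 0) (h₂ : ⟪x₂, N₁⟫ = 0) (h₂' : ⟪x₂, N₂⟫ = 0)
    (h₃ : ⟪x₃, N₁⟫ = 0) (h₃' : ⟪x₃, N₂⟫ = 0) (h₄ : ⟪x₄, N₁⟫ = 0) (h₄' : ⟪x₄, N₂⟫ = 0) :
    Phi σ ![x₁, x₂, x₃, x₄] = -(σ / 2) * (ω ⋏ ω) ![x₁, x₂, x₃, x₄] := by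
  have hphi (x y z w : E8) : ⟪P x y z, w⟫ = phi σ x y z w := by rw [hP, Phi_apply]
  have hPP (a b c x y z : E8) := calc
    ⟪P a b c, P x y z⟫ = ∑ h, phi σ a b c (EuclideanSpace.single h 1)
        * phi σ x y z (EuclideanSpace.single h 1) := by
      simp [← hphi, PiLp.inner_apply, mul_comm]
    _ = _ := sum_phi_mul_phi hσ a b c x y z
  have h₁₂ (x z w : E8) : phi σ x x z w = 0 := by linarith [phi_swap₁₂ σ x x z w]
  have h₂₃ (x z w : E8) : phi σ z x x w = 0 := by linarith [phi_swap₂₃ σ z x x w]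
  have h₁₃ (x z w : E8) : phi σ x z x w = 0 := by rw [phi_swap₂₃, h₁₂, neg_zero]
  have h₂₄ (x z w : E8) : phi σ z x w x = 0 := by rw [phi_swap₃₄, h₂₃, neg_zero]
  have h₁₄ (x z w : E8) : phi σ x z w x = 0 := by rw [phi_swap₃₄, h₁₃, neg_zero]
  have hN₂₁ : ⟪N₂, N₁⟫ = 0 := by rw [real_inner_comm, hN₁₂]
  have hJJ : P N₁ N₂ (P N₁ N₂ x₄) = -x₄ := by
    refine ext_inner_right ℝ fun w => ?_
    have h := hPP N₁ N₂ w N₁ N₂ x₄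
    rw [real_inner_comm] at h₄ h₄'
    simp only [hN₁, hN₂, hN₁₂, hN₂₁, h₄, h₄', h₂₃, h₁₃, h₂₄, h₁₄] at h
    rw [hphi, phi_swap₃₄, ← hphi, h, inner_neg_left, real_inner_comm]
    ring
  have hJ (x y : E8) : ω ![x, y] = phi σ N₁ N₂ y x := by
    rw [hω, ← hphi, real_inner_comm]
    rfl
  have h := hPP x₁ x₂ x₃ N₁ N₂ (P N₁ N₂ x₄)
  rw [hJJ] at h
  simp only [real_inner_comm (P N₁ N₂ x₄), hphi, phi_comm σ N₁ N₂, h₁, h₁', h₂, h₂', h₃, h₃',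
    ← neg_one_smul ℝ x₄, phi_smul₄] at h
  have hanti (x y : E8) : ω ![y, x] = -ω ![x, y] := by rw [hJ, hJ, phi_swap₃₄]
  rw [Phi_apply, wedge_self_apply ω hanti]
  simp only [Matrix.cons_val, hJ]
  linear_combination -h + σ * phi σ N₁ N₂ x₄ x₁ * phi_swap₃₄ σ N₁ N₂ x₂ x₃
    + σ * phi σ N₁ N₂ x₄ x₃ * phi_swap₃₄ σ N₁ N₂ x₁ x₂
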